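/- arXiv:1602.05394 — 2 statements merged into one kernel-verified Lean document; each statement's English description precedes it below -/
import Mathlib

section
/- Abel-summation bound for slowly varying dual sequences (key step in the proof of the S_e bound): Let T ≥ 2, let e_1,…,e_T ∈ ℝ^m with mean ē = (1/T) Σ_{j=1}^T e_j, let ε ≥ 0, and let λ_1,…,λ_T ∈ ℝ^m satisfy Σ_{t=1}^{T−1} ‖λ_t − λ_{t+1}‖₂ ≤ ε. Then Σ_{t=1}^T ⟨λ_t, e_t − ē⟩ ≤ ε · max_{1 ≤ t ≤ T−1} Ψ_t, where Ψ_t = ‖ Σ_{j=1}^t ((T−t)/T) e_j − Σ_{j=t+1}^T (t/T) e_j ‖₂. -/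
local notation "⟪" x ", " y "⟫" => @inner ℝ _ _ x y

/-- Abel summation for inner products. -/
theorem sum_inner_eq_inner_sum_add {E : Type*} [NormedAddCommGroup E] [InnerProductSpace ℝ E]
    (u x : ℕ → E) (n : ℕ) :
    ∑ t ∈ Finset.range (n + 1), ⟪u t, x t⟫ =
      ⟪u n, ∑ j ∈ Finset.range (n + 1), x j⟫ +
        ∑ t ∈ Finset.range n, ⟪u t - u (t + 1), ∑ j ∈ Finset.range (t + 1), x j⟫ := by
  induction n with
  | zero => simp
  | succ k ih =>
    rw [Finset.sum_range_succ, ih,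
      Finset.sum_range_succ (fun t => ⟪u t - u (t + 1), ∑ j ∈ Finset.range (t + 1), x j⟫) k,
      Finset.sum_range_succ x (k + 1), inner_sub_left, inner_add_right]
    ring

/-- A partial sum of deviations from the mean, as a weighted difference of the sums of the first
`t` and of the remaining vectors. -/
theorem sum_range_sub_mean {E : Type*} [AddCommGroup E] [Module ℝ E] (e : ℕ → E) {t T : ℕ}
    (hT : T ≠ 0) (htT : t ≤ T) :
    ∑ j ∈ Finset.range t, (e j - (1 / T : ℝ) • ∑ i ∈ Finset.range T, e i) =
      (((T : ℝ) - t) / T) • (∑ j ∈ Finset.range t, e j) -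
        ((t : ℝ) / T) • ∑ j ∈ Finset.Ico t T, e j := by
  have hT' : (T : ℝ) ≠ 0 := Nat.cast_ne_zero.mpr hT
  rw [Finset.sum_sub_distrib, Finset.sum_const, Finset.card_range,
    ← Finset.sum_range_add_sum_Ico e htT, ← Nat.cast_smul_eq_nsmul ℝ]
  match_scalars <;> field_simp

/-- Abel-summation bound for slowly varying dual sequences (key step in the proof
of the `S_e` bound).  `e 0, …, e (T-1)` stand for `e_1, …, e_T`, and
`lam 0, …, lam (T-1)` for `λ_1, …, λ_T`.  For the paper's index `t ∈ {1, …, T-1}`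
(here `t = s + 1` with `s ∈ range (T-1)`), `Ψ_t` is written with 0-based index sums
over `range t` and `Ico t T`. -/
theorem stmt_4 {m : ℕ} (T : ℕ) (hT : 2 ≤ T)
    (e : ℕ → EuclideanSpace ℝ (Fin m))
    (ebar : EuclideanSpace ℝ (Fin m))
    (hebar : ebar = (1 / T : ℝ) • ∑ j ∈ Finset.range T, e j)
    (ε : ℝ) (hε : 0 ≤ ε)
    (lam : ℕ → EuclideanSpace ℝ (Fin m))
    (hlam : ∑ t ∈ Finset.range (T - 1), ‖lam t - lam (t + 1)‖ ≤ ε) :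
    ∑ t ∈ Finset.range T, ⟪lam t, e t - ebar⟫ ≤
      ε * ((Finset.range (T - 1)).sup' (Finset.nonempty_range_iff.mpr (by omega))
        fun s => ‖(((T : ℝ) - (s + 1)) / T) • (∑ j ∈ Finset.range (s + 1), e j) -
          (((s : ℝ) + 1) / T) • ∑ j ∈ Finset.Ico (s + 1) T, e j‖) := by
  obtain ⟨n, rfl⟩ : ∃ n, T = n + 1 := ⟨T - 1, by omega⟩
  subst hebar
  have hzero : ∑ j ∈ Finset.range (n + 1),
      (e j - (1 / ((n + 1 : ℕ) : ℝ)) • ∑ i ∈ Finset.range (n + 1), e i) = 0 := by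
    rw [sum_range_sub_mean e n.succ_ne_zero le_rfl]
    simp
  rw [sum_inner_eq_inner_sum_add, hzero, inner_zero_right, zero_add]
  set M := Finset.sup' (α := ℝ) (Finset.range (n + 1 - 1)) _ _ with hM
  have hle : ∀ t ∈ Finset.range n, ‖∑ j ∈ Finset.range (t + 1),
      (e j - (1 / ((n + 1 : ℕ) : ℝ)) • ∑ i ∈ Finset.range (n + 1), e i)‖ ≤ M := by
    intro t ht
    rw [sum_range_sub_mean e n.succ_ne_zero (by have := Finset.mem_range.mp ht; omega), hM,
      Nat.cast_succ t]
    exact Finset.le_sup' (fun s : ℕ => ‖((((n + 1 : ℕ) : ℝ) - (s + 1)) / (n + 1 : ℕ)) •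
      (∑ j ∈ Finset.range (s + 1), e j) -
        (((s : ℝ) + 1) / (n + 1 : ℕ)) • ∑ j ∈ Finset.Ico (s + 1) (n + 1), e j‖) ht
  have hM0 : 0 ≤ M := (norm_nonneg _).trans (hle 0 (Finset.mem_range.mpr (by omega)))
  calc _ ≤ ∑ t ∈ Finset.range n, ‖lam t - lam (t + 1)‖ * M :=
        Finset.sum_le_sum fun t ht => (real_inner_le_norm _ _).trans
          (mul_le_mul_of_nonneg_left (hle t ht) (norm_nonneg _))
    _ = (∑ t ∈ Finset.range n, ‖lam t - lam (t + 1)‖) * M := (Finset.sum_mul _ _ _).symm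
    _ ≤ ε * M := mul_le_mul_of_nonneg_right hlam hM0
end

section
/- Lemma 5, second part (bound on the matrix-estimation term S_A): Under the hypotheses of the first part of Lemma 5 — 𝒜 a nonempty closed convex subset of ℝ^{m×d} with ‖A‖_F ≤ R_A for all A ∈ 𝒜, matrices A_1,…,A_{T+1} ∈ 𝒜, and estimates Â_1 ∈ 𝒜, Â_{t+1} = Π_𝒜(Â_t − (R_A/√t) G_t) where ‖G_t‖_F ≤ 1 and ‖A_t − B‖_F ≥ ‖A_t − Â_t‖_F + ⟨G_t, B − Â_t⟩ for all B ∈ 𝒜 — suppose in addition that λ̂_1,…,λ̂_T ∈ ℝ^m satisfy ‖λ̂_t‖₂ ≤ R_λ and x*_1,…,x*_T, x̂_1,…,x̂_T ∈ ℝ^d satisfy ‖x*_t‖₂ ≤ R_x and ‖x̂_t‖₂ ≤ R_x. Then (1/T) Σ_{t=1}^T λ̂_tᵀ (Â_t − A_t)(x*_t − x̂_t) ≤ (6 R_λ R_x/√T) [ R_A + Σ_{t=1}^T ‖A_t − A_{t+1}‖_F ]. -/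
local notation "⟪" x ", " y "⟫" => @inner ℝ _ _ x y

/-- A nearest point of a convex set is at least as close to every point of the set as the
projected point is. -/
theorem norm_sub_le_of_forall_norm_sub_le {E : Type*} [NormedAddCommGroup E]
    [InnerProductSpace ℝ E] {K : Set E} (hK : Convex ℝ K) {u p w : E} (hp : p ∈ K)
    (hmin : ∀ z ∈ K, ‖u - p‖ ≤ ‖u - z‖) (hw : w ∈ K) : ‖p - w‖ ≤ ‖u - w‖ := by
  have hinf : ‖u - p‖ = ⨅ z : K, ‖u - z‖ := by
    have : Nonempty K := ⟨⟨p, hp⟩⟩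
    refine le_antisymm (le_ciInf fun z => hmin z z.2) ?_
    exact ciInf_le (f := fun z : K => ‖u - z‖)
      ⟨0, by rintro _ ⟨z, rfl⟩; exact norm_nonneg _⟩ ⟨p, hp⟩
  have hinner := (norm_eq_iInf_iff_real_inner_le_zero hK hp).1 hinf w hw
  have hexp := norm_sub_sq_real (u - p) (w - p)
  rw [sub_sub_sub_cancel_right, norm_sub_rev w p] at hexp
  refine le_of_sq_le_sq ?_ (norm_nonneg _)
  nlinarith [sq_nonneg ‖u - p‖]

/-- One step of projected subgradient descent on the loss `‖a - ·‖`. -/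
theorem projected_subgradient_step {E : Type*} [NormedAddCommGroup E]
    [InnerProductSpace ℝ E] {K : Set E} (hK : Convex ℝ K) {a x g y : E} {η : ℝ} (hη : 0 ≤ η)
    (ha : a ∈ K) (hg : ‖g‖ ≤ 1) (hsub : ‖a - x‖ + inner ℝ g (a - x) ≤ 0) (hy : y ∈ K)
    (hmin : ∀ z ∈ K, ‖x - η • g - y‖ ≤ ‖x - η • g - z‖) :
    2 * η * ‖a - x‖ ≤ ‖a - x‖ ^ 2 - ‖a - y‖ ^ 2 + η ^ 2 := by
  have hle := norm_sub_le_of_forall_norm_sub_le hK hy hmin ha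
  have hsq := pow_le_pow_left₀ (norm_nonneg _) hle 2
  have hexp := norm_add_sq_real (a - x) (η • g)
  rw [← norm_neg, show -(a - x + η • g) = x - η • g - a by abel, norm_smul, mul_pow,
    Real.norm_eq_abs, sq_abs, real_inner_smul_right, real_inner_comm] at hexp
  rw [norm_sub_rev y a] at hsq
  have hg2 : ‖g‖ ^ 2 ≤ 1 := pow_le_one₀ (norm_nonneg _) hg
  nlinarith [mul_le_mul_of_nonneg_left hg2 (sq_nonneg η),
    mul_le_mul_of_nonneg_left hsub hη]

/-- Squared distances to two points of a ball of radius `R` differ by at most `4 * R` times the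
distance of these points. -/
theorem norm_sub_sq_le_add_of_norm_le {E : Type*} [NormedAddCommGroup E] {a b y : E} {R : ℝ}
    (ha : ‖a‖ ≤ R) (hb : ‖b‖ ≤ R) (hy : ‖y‖ ≤ R) :
    ‖b - y‖ ^ 2 ≤ ‖a - y‖ ^ 2 + 4 * R * ‖a - b‖ := by
  have h1 := norm_sub_le a y
  have h2 := norm_sub_le b y
  have h3 : ‖b - y‖ ≤ ‖a - y‖ + ‖a - b‖ := by
    rw [norm_sub_rev a b, add_comm]
    exact norm_sub_le_norm_sub_add_norm_sub b a y
  nlinarith [norm_nonneg (a - y), norm_nonneg (b - y), norm_nonneg (a - b),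
    mul_nonneg (norm_nonneg (a - b)) (show 0 ≤ 4 * R - ‖a - y‖ - ‖b - y‖ by linarith),
    mul_nonneg (show 0 ≤ ‖a - y‖ + ‖b - y‖ by positivity)
      (show 0 ≤ ‖a - y‖ + ‖a - b‖ - ‖b - y‖ by linarith)]

/-- Summing the descent recursion with step sizes `R / √(t + 1)`. -/
theorem sum_le_of_descent_recursion {R : ℝ} (hR : 0 < R) {T : ℕ} {D p : ℕ → ℝ}
    (hD0 : ∀ t ≤ T, 0 ≤ D t) (hD : ∀ t ≤ T, D t ≤ 2 * R) (hp : ∀ t, 0 ≤ p t)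
    (hstep : ∀ t < T, 2 * (R / √(t + 1)) * D t ≤
      D t ^ 2 - D (t + 1) ^ 2 + 4 * R * p t + (R / √(t + 1)) ^ 2) :
    ∑ t ∈ Finset.range T, D t ≤ 3 * √T * (R + ∑ t ∈ Finset.range T, p t) := by
  have key : ∀ n ≤ T, ∑ t ∈ Finset.range n, D t + √n / (2 * R) * D n ^ 2 ≤
      3 * R * √n + 2 * √n * ∑ t ∈ Finset.range n, p t := by
    intro n
    induction n with
    | zero => simp
    | succ n ih =>
      intro hn
      have ih := ih (by omega)
      have hs := hstep n (by omega)
      have hDn0 := hD0 n (by omega)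
      have hDn := hD n (by omega)
      rw [Finset.sum_range_succ, Finset.sum_range_succ]
      push_cast
      have hP : 0 ≤ ∑ t ∈ Finset.range n, p t := Finset.sum_nonneg fun t _ => hp t
      set S := ∑ t ∈ Finset.range n, D t
      set P := ∑ t ∈ Finset.range n, p t
      have hr2 : √(n : ℝ) ^ 2 = n := Real.sq_sqrt (by positivity)
      have hs2 : √((n : ℝ) + 1) ^ 2 = n + 1 := Real.sq_sqrt (by positivity)
      have hspos : 0 < √((n : ℝ) + 1) := Real.sqrt_pos.2 (by positivity)
      have hmono : √(n : ℝ) ≤ √((n : ℝ) + 1) := Real.sqrt_le_sqrt (by linarith)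
      have hr0 := Real.sqrt_nonneg (n : ℝ)
      set r := √(n : ℝ)
      set s := √((n : ℝ) + 1)
      have hdescent : D n + s / (2 * R) * D (n + 1) ^ 2 ≤
          s / (2 * R) * D n ^ 2 + 2 * s * p n + R / (2 * s) := by
        have h := mul_le_mul_of_nonneg_left hs (show 0 ≤ s / (2 * R) by positivity)
        have e1 : s / (2 * R) * (2 * (R / s) * D n) = D n := by field_simp
        have e2 : s / (2 * R) * (D n ^ 2 - D (n + 1) ^ 2 + 4 * R * p n + (R / s) ^ 2) =
            s / (2 * R) * D n ^ 2 - s / (2 * R) * D (n + 1) ^ 2 + 2 * s * p n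
              + R / (2 * s) := by
          field_simp
          ring
        linarith
      have hstepsize : R / (2 * s) ≤ R * (s - r) := by
        rw [div_le_iff₀ (by positivity)]
        nlinarith [mul_nonneg hR.le (sq_nonneg (s - r))]
      have hpotential : s / (2 * R) * D n ^ 2 ≤ r / (2 * R) * D n ^ 2 + 2 * R * (s - r) := by
        have h := mul_le_mul_of_nonneg_left (pow_le_pow_left₀ hDn0 hDn 2)
          (show 0 ≤ (s - r) / (2 * R) from div_nonneg (by linarith) (by positivity))
        have e1 : (s - r) / (2 * R) * (2 * R) ^ 2 = 2 * R * (s - r) := by field_simp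
        have e2 : (s - r) / (2 * R) * D n ^ 2 =
            s / (2 * R) * D n ^ 2 - r / (2 * R) * D n ^ 2 := by ring
        linarith
      nlinarith [mul_le_mul_of_nonneg_right hmono hP]
  have hT := key T le_rfl
  have hP : 0 ≤ ∑ t ∈ Finset.range T, p t := Finset.sum_nonneg fun t _ => hp t
  have h1 : 0 ≤ √T / (2 * R) * D T ^ 2 := by positivity
  nlinarith [mul_nonneg (Real.sqrt_nonneg (T : ℝ)) hP]

/-- A bilinear form is bounded by the Frobenius norm of its matrix. -/
theorem sum_sum_mul_le_norm_mul_norm_mul_norm {ι κ : Type*} [Fintype ι] [Fintype κ]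
    (l : EuclideanSpace ℝ ι) (M : EuclideanSpace ℝ (ι × κ)) (v : EuclideanSpace ℝ κ) :
    ∑ i, ∑ j, l i * M (i, j) * v j ≤ ‖l‖ * ‖v‖ * ‖M‖ := by
  have hcs := Finset.sum_mul_sq_le_sq_mul_sq Finset.univ
    (fun q : ι × κ => l q.1 * v q.2) (fun q => M q)
  have hprod : ∑ q : ι × κ, (l q.1 * v q.2) ^ 2 = ‖l‖ ^ 2 * ‖v‖ ^ 2 := by
    rw [EuclideanSpace.real_norm_sq_eq, EuclideanSpace.real_norm_sq_eq, Finset.sum_mul_sum,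
      Fintype.sum_prod_type]
    simp only [mul_pow]
  rw [hprod, ← EuclideanSpace.real_norm_sq_eq] at hcs
  have hsum : ∑ i, ∑ j, l i * M (i, j) * v j = ∑ q : ι × κ, l q.1 * v q.2 * M q := by
    rw [Fintype.sum_prod_type]
    exact Finset.sum_congr rfl fun i _ => Finset.sum_congr rfl fun j _ => by ring
  rw [hsum]
  refine le_of_sq_le_sq ?_ (by positivity)
  simpa only [mul_pow] using hcs

/-- Lemma 5, second part (bound on the matrix-estimation term `S_A`).
Setup as in the first part of Lemma 5: `ℝ^{m×d}` with the Frobenius inner product is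
`EuclideanSpace ℝ (Fin m × Fin d)`, rounds are 0-indexed, `A 0, …, A T` are the
matrices `A_1, …, A_{T+1}`, and the projection step encodes
`Â_{t+1} = Π_𝒜(Â_t − (R_A/√t) G_t)`.  The bilinear term `λ̂_tᵀ(Â_t − A_t)(x*_t − x̂_t)`
is written entrywise as `∑ i, ∑ j, λ̂_t i · (Â_t − A_t)(i,j) · (x*_t − x̂_t) j`. -/
theorem stmt_9 {m d : ℕ}
    (𝒜 : Set (EuclideanSpace ℝ (Fin m × Fin d)))
    (h𝒜ne : 𝒜.Nonempty) (h𝒜closed : IsClosed 𝒜) (h𝒜convex : Convex ℝ 𝒜)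
    (RA : ℝ) (hRA : 0 < RA) (h𝒜bdd : ∀ B ∈ 𝒜, ‖B‖ ≤ RA)
    (T : ℕ) (hT : 1 ≤ T)
    (A : ℕ → EuclideanSpace ℝ (Fin m × Fin d))
    (hAmem : ∀ t ∈ Finset.range (T + 1), A t ∈ 𝒜)
    (Ahat Gsub : ℕ → EuclideanSpace ℝ (Fin m × Fin d))
    (hAhat0 : Ahat 0 ∈ 𝒜)
    (hGnorm : ∀ t ∈ Finset.range T, ‖Gsub t‖ ≤ 1)
    (hGsubgrad : ∀ t ∈ Finset.range T, ∀ B ∈ 𝒜,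
      ‖A t - B‖ ≥ ‖A t - Ahat t‖ + ⟪Gsub t, B - Ahat t⟫)
    (hproj : ∀ t ∈ Finset.range T, Ahat (t + 1) ∈ 𝒜 ∧
      ∀ B ∈ 𝒜, ‖Ahat t - (RA / Real.sqrt (t + 1)) • Gsub t - Ahat (t + 1)‖ ≤
        ‖Ahat t - (RA / Real.sqrt (t + 1)) • Gsub t - B‖)
    (Rlam Rx : ℝ)
    (lamhat : ℕ → EuclideanSpace ℝ (Fin m))
    (hlam : ∀ t ∈ Finset.range T, ‖lamhat t‖ ≤ Rlam)
    (xstar xhat : ℕ → EuclideanSpace ℝ (Fin d))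
    (hxstar : ∀ t ∈ Finset.range T, ‖xstar t‖ ≤ Rx)
    (hxhat : ∀ t ∈ Finset.range T, ‖xhat t‖ ≤ Rx) :
    (1 / T : ℝ) * ∑ t ∈ Finset.range T, ∑ i, ∑ j,
        lamhat t i * (Ahat t - A t) (i, j) * (xstar t j - xhat t j) ≤
      (6 * Rlam * Rx / Real.sqrt T) *
        (RA + ∑ t ∈ Finset.range T, ‖A t - A (t + 1)‖) := by
  have hAhat : ∀ t ≤ T, Ahat t ∈ 𝒜 := by
    rintro (_ | t) ht
    · exact hAhat0
    · exact (hproj t (Finset.mem_range.2 (by omega))).1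
  have hA : ∀ t ≤ T, A t ∈ 𝒜 := fun t ht => hAmem t (Finset.mem_range.2 (by omega))
  have hregret : ∑ t ∈ Finset.range T, ‖A t - Ahat t‖ ≤
      3 * √T * (RA + ∑ t ∈ Finset.range T, ‖A t - A (t + 1)‖) := by
    refine sum_le_of_descent_recursion hRA (fun t _ => norm_nonneg _) (fun t ht => ?_)
      (fun t => norm_nonneg _) (fun t ht => ?_)
    · linarith [norm_sub_le (A t) (Ahat t), h𝒜bdd _ (hA t ht), h𝒜bdd _ (hAhat t ht)]
    · have hmem := Finset.mem_range.2 ht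
      have hsub := hGsubgrad t hmem (A t) (hA t ht.le)
      rw [sub_self, norm_zero] at hsub
      have hdesc := projected_subgradient_step h𝒜convex
        (show 0 ≤ RA / √((t : ℝ) + 1) by positivity) (hA t ht.le) (hGnorm t hmem) hsub
        (hproj t hmem).1 (hproj t hmem).2
      have hdrift := norm_sub_sq_le_add_of_norm_le (h𝒜bdd _ (hA t ht.le))
        (h𝒜bdd _ (hA (t + 1) ht)) (h𝒜bdd _ (hAhat (t + 1) ht))
      linarith
  have h0 : 0 ∈ Finset.range T := Finset.mem_range.2 hT
  have hRlam : 0 ≤ Rlam := (norm_nonneg _).trans (hlam 0 h0)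
  have hRx : 0 ≤ Rx := (norm_nonneg _).trans (hxstar 0 h0)
  have hbilin : ∑ t ∈ Finset.range T, ∑ i, ∑ j,
        lamhat t i * (Ahat t - A t) (i, j) * (xstar t j - xhat t j) ≤
      Rlam * (2 * Rx) * ∑ t ∈ Finset.range T, ‖A t - Ahat t‖ := by
    rw [Finset.mul_sum]
    refine Finset.sum_le_sum fun t ht => ?_
    refine (sum_sum_mul_le_norm_mul_norm_mul_norm (lamhat t) (Ahat t - A t)
      (xstar t - xhat t)).trans ?_
    rw [norm_sub_rev (Ahat t)]
    have hx : ‖xstar t - xhat t‖ ≤ 2 * Rx := by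
      linarith [norm_sub_le (xstar t) (xhat t), hxstar t ht, hxhat t ht]
    gcongr
    exact hlam t ht
  have hTpos : (0 : ℝ) < T := by exact_mod_cast hT
  calc _ ≤ (1 / T : ℝ) * (Rlam * (2 * Rx) *
        (3 * √T * (RA + ∑ t ∈ Finset.range T, ‖A t - A (t + 1)‖))) := by
        refine mul_le_mul_of_nonneg_left (hbilin.trans ?_) (by positivity)
        exact mul_le_mul_of_nonneg_left hregret (by positivity)
    _ = _ := by
        have hsq : √(T : ℝ) ^ 2 = T := Real.sq_sqrt hTpos.le
        have hspos : 0 < √(T : ℝ) := Real.sqrt_pos.2 hTpos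
        field_simp
        rw [hsq]
        ring
end
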